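/- Let d ≥ 1, let m, p, q ≥ 1 be integers, μ ≥ 0, b, c ∈ ℝ, s > d/2, s₁ ∈ (d/2, s) with s − s₁ ≤ m, M > 0 and ε ∈ (0, 1). Suppose v : [0, 1] → h^s is continuously differentiable, satisfies |v(τ)|_s ≤ M for all τ ∈ [0, 1], and solves coordinatewise d/dτ v_k(τ) = ε⁻¹ i λ_k v_k(τ) − μ λ_k^m v_k(τ) + b P_k(v(τ), p) + i c P_k(v(τ), q) for all k ∈ ℤ^d. Let a(τ) be the sequence with entries a_k(τ) = e^{−i ε⁻¹ λ_k τ} v_k(τ), let Y(w, τ) = Φ_{−τε⁻¹Λ} P(Φ_{τε⁻¹Λ} w) and R(w) = (b R_k(w, p) + i c R_k(w, q))_{k∈ℤ^d}. Then there exists a constant C, depending only on d, m, p, q, μ, b, c, s, s₁ and M (and not on ε), such that for every τ̃ ∈ [0, 1] one has | ∫₀^{τ̃} ( Y(a(τ), τ) − R(a(τ)) ) dτ |_{s₁} ≤ C (ε^{(s−s₁)/m} + ε^{1/2}). -/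

import Mathlib

open scoped BigOperators

/-- `lam d k = |k|²`, the squared Euclidean norm of `k ∈ ℤ^d`. -/
def lam (d : ℕ) (k : Fin d → ℤ) : ℤ := ∑ i, (k i) ^ 2

/-- The weight `|k|^{2s} + 1 = (|k|²)^s + 1` in the definition of the `h^s` norm. -/
noncomputable def wt (d : ℕ) (s : ℝ) (k : Fin d → ℤ) : ℝ := ((lam d k : ℝ)) ^ s + 1

/-- `v ∈ h^s`, i.e. the series defining `|v|_s²` converges. -/
def memH (d : ℕ) (s : ℝ) (v : (Fin d → ℤ) → ℂ) : Prop :=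
  Summable fun k => wt d s k * ‖v k‖ ^ 2

/-- The norm `|v|_s` of `h^s`. -/
noncomputable def hnorm (d : ℕ) (s : ℝ) (v : (Fin d → ℤ) → ℂ) : ℝ :=
  Real.sqrt (∑' k, wt d s k * ‖v k‖ ^ 2)

/-- The summand of `P_k(v,n)`: the monomial `v_{k₁} conj(v_{k₂}) ⋯ v_{k_{2n+1}}` if the
tuple `κ` lies in `S(k,n)` (i.e. the alternating sum of `κ` equals `k`), and `0` otherwise. -/
noncomputable def Pterm (d n : ℕ) (v : (Fin d → ℤ) → ℂ) (k : Fin d → ℤ)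
    (κ : Fin (2 * n + 1) → (Fin d → ℤ)) : ℂ :=
  if (∑ j : Fin (2 * n + 1), ((-1 : ℤ) ^ (j : ℕ)) • κ j) = k then
    ∏ j : Fin (2 * n + 1), (if Even (j : ℕ) then v (κ j) else (starRingEnd ℂ) (v (κ j)))
  else 0

/-- `P_k(v,n) = Σ_{(k₁,…,k_{2n+1}) ∈ S(k,n)} v_{k₁} conj(v_{k₂}) ⋯ v_{k_{2n+1}}`. -/
noncomputable def Pk (d n : ℕ) (v : (Fin d → ℤ) → ℂ) (k : Fin d → ℤ) : ℂ :=
  ∑' κ : Fin (2 * n + 1) → (Fin d → ℤ), Pterm d n v k κ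

/-- The summand of `R_k(v,n)`: as `Pterm`, but restricted to resonant tuples. -/
noncomputable def Rterm (d n : ℕ) (v : (Fin d → ℤ) → ℂ) (k : Fin d → ℤ)
    (κ : Fin (2 * n + 1) → (Fin d → ℤ)) : ℂ :=
  if (∑ j : Fin (2 * n + 1), ((-1 : ℤ) ^ (j : ℕ)) • κ j) = k ∧
      (∑ j : Fin (2 * n + 1), ((-1 : ℤ) ^ (j : ℕ)) * lam d (κ j)) = lam d k then
    ∏ j : Fin (2 * n + 1), (if Even (j : ℕ) then v (κ j) else (starRingEnd ℂ) (v (κ j)))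
  else 0

/-- `R_k(v,n)`, the resonant part of `P_k(v,n)`. -/
noncomputable def Rk (d n : ℕ) (v : (Fin d → ℤ) → ℂ) (k : Fin d → ℤ) : ℂ :=
  ∑' κ : Fin (2 * n + 1) → (Fin d → ℤ), Rterm d n v k κ

/-- Continuity of a curve `v : [0,T] → h^s` with respect to the norm `|·|_s`. -/
def hContOn (d : ℕ) (s : ℝ) (T : ℝ) (v : ℝ → (Fin d → ℤ) → ℂ) : Prop :=
  ∀ τ₀ ∈ Set.Icc (0 : ℝ) T,
    Filter.Tendsto (fun τ => hnorm d s (fun k => v τ k - v τ₀ k))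
      (nhdsWithin τ₀ (Set.Icc 0 T)) (nhds 0)


open MeasureTheory Set

open scoped ENNReal

section Weights

variable {d : ℕ}

lemma lam_nonneg (k : Fin d → ℤ) : 0 ≤ lam d k :=
  Finset.sum_nonneg fun _ _ => sq_nonneg _

lemma lam_cast_nonneg (k : Fin d → ℤ) : (0 : ℝ) ≤ lam d k := by
  exact_mod_cast lam_nonneg k

lemma lam_smul_of_sq_eq_one {σ : ℤ} (hσ : σ ^ 2 = 1) (k : Fin d → ℤ) :
    lam d (σ • k) = lam d k := by
  simp [lam, mul_pow, hσ]

lemma lam_add_le (k l : Fin d → ℤ) : lam d (k + l) ≤ 2 * (lam d k + lam d l) := by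
  simp only [lam, ← Finset.sum_add_distrib, Finset.mul_sum, Pi.add_apply]
  exact Finset.sum_le_sum fun i _ => by nlinarith [sq_nonneg (k i - l i)]

lemma one_le_wt (s : ℝ) (k : Fin d → ℤ) : 1 ≤ wt d s k := by
  have := Real.rpow_nonneg (lam_cast_nonneg k) s
  simp only [wt]; linarith

lemma wt_nonneg (s : ℝ) (k : Fin d → ℤ) : 0 ≤ wt d s k := zero_le_one.trans (one_le_wt s k)

lemma wt_smul_of_sq_eq_one {σ : ℤ} (hσ : σ ^ 2 = 1) (s : ℝ) (k : Fin d → ℤ) :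
    wt d s (σ • k) = wt d s k := by
  simp only [wt, lam_smul_of_sq_eq_one hσ]

lemma wt_add_le {s : ℝ} (hs : 0 ≤ s) (k l : Fin d → ℤ) :
    wt d s (k + l) ≤ 4 ^ s * (wt d s k + wt d s l) := by
  have hk := lam_cast_nonneg k
  have hl := lam_cast_nonneg l
  have hkl := lam_cast_nonneg (k + l)
  have h4 : (1 : ℝ) ≤ 4 ^ s := Real.one_le_rpow (by norm_num) hs
  have h : (lam d (k + l) : ℝ) ≤ 2 * (lam d k + lam d l) := by exact_mod_cast lam_add_le k l
  have key : (lam d (k + l) : ℝ) ^ s ≤ 4 ^ s * ((lam d k : ℝ) ^ s + (lam d l : ℝ) ^ s) := by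
    rcases le_total (lam d k : ℝ) (lam d l) with hle | hle
    · calc (lam d (k + l) : ℝ) ^ s ≤ (4 * lam d l : ℝ) ^ s :=
            Real.rpow_le_rpow hkl (by linarith) hs
        _ = 4 ^ s * (lam d l : ℝ) ^ s := Real.mul_rpow (by norm_num) hl
        _ ≤ _ := by gcongr; linarith [Real.rpow_nonneg hk s]
    · calc (lam d (k + l) : ℝ) ^ s ≤ (4 * lam d k : ℝ) ^ s :=
            Real.rpow_le_rpow hkl (by linarith) hs
        _ = 4 ^ s * (lam d k : ℝ) ^ s := Real.mul_rpow (by norm_num) hk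
        _ ≤ _ := by gcongr; linarith [Real.rpow_nonneg hl s]
  simp only [wt]
  linarith

lemma wt_le_two_mul_wt {s t : ℝ} (hs : 0 < s) (hst : s ≤ t) (k : Fin d → ℤ) :
    wt d s k ≤ 2 * wt d t k := by
  have ht := one_le_wt t k
  suffices (lam d k : ℝ) ^ s ≤ wt d t k by simp only [wt] at *; linarith
  rcases (lam_nonneg k).eq_or_lt with h | h
  · rw [← h, Int.cast_zero, Real.zero_rpow hs.ne']; linarith
  · have h1 : (1 : ℝ) ≤ lam d k := by exact_mod_cast h
    exact (Real.rpow_le_rpow_of_exponent_le h1 hst).trans (by simp [wt])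

/-- The weight `wt` as an extended nonnegative real. -/
noncomputable def ewt (d : ℕ) (s : ℝ) (k : Fin d → ℤ) : ℝ≥0∞ := ENNReal.ofReal (wt d s k)

lemma ewt_ne_zero (s : ℝ) (k : Fin d → ℤ) : ewt d s k ≠ 0 := by
  simpa [ewt] using zero_lt_one.trans_le (one_le_wt s k)

lemma ewt_ne_top (s : ℝ) (k : Fin d → ℤ) : ewt d s k ≠ ∞ := ENNReal.ofReal_ne_top

lemma ewt_smul_of_sq_eq_one {σ : ℤ} (hσ : σ ^ 2 = 1) (s : ℝ) (k : Fin d → ℤ) :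
    ewt d s (σ • k) = ewt d s k := by
  rw [ewt, wt_smul_of_sq_eq_one hσ, ewt]

lemma ewt_add_le {s : ℝ} (hs : 0 ≤ s) (k l : Fin d → ℤ) :
    ewt d s (k + l) ≤ ENNReal.ofReal (4 ^ s) * (ewt d s k + ewt d s l) := by
  rw [ewt, ewt, ewt, ← ENNReal.ofReal_add (wt_nonneg s k) (wt_nonneg s l),
    ← ENNReal.ofReal_mul (by positivity)]
  exact ENNReal.ofReal_le_ofReal (wt_add_le hs k l)

lemma ENNReal.tsum_prod_eq_prod_tsum {α : Type*} {n : ℕ} (f : Fin n → α → ℝ≥0∞) :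
    ∑' κ : Fin n → α, ∏ i, f i (κ i) = ∏ i, ∑' x, f i x := by
  induction n with
  | zero => simp
  | succ n ih =>
    rw [← (Fin.consEquiv fun _ => α).tsum_eq, ENNReal.tsum_prod', Fin.prod_univ_succ, ← ih,
      ← ENNReal.tsum_mul_right]
    simp [Fin.prod_univ_succ, ENNReal.tsum_mul_left]

lemma summable_one_add_sq_rpow_neg {r : ℝ} (hr : 1 / 2 < r) :
    Summable fun n : ℤ => (1 + (n : ℝ) ^ 2) ^ (-r) := by
  have h := ((Real.summable_one_div_int_add_rpow (1 / 2) (2 * r)).2 (by linarith)).mul_left (2 ^ r)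
  refine h.of_nonneg_of_le (fun n => by positivity) fun n => ?_
  have hx : 0 < |(n : ℝ) + 1 / 2| := by
    rw [abs_pos]
    intro h0
    have : (2 * n + 1 : ℝ) = 0 := by linarith
    have : 2 * n + 1 = 0 := by exact_mod_cast this
    omega
  rw [Real.rpow_mul hx.le, Real.rpow_two, sq_abs, ← mul_div_assoc, mul_one,
    ← Real.div_rpow (by norm_num) (by positivity), Real.rpow_neg (by positivity),
    ← Real.inv_rpow (by positivity)]
  refine Real.rpow_le_rpow (by positivity) ?_ (by linarith)
  rw [abs_pos] at hx
  rw [inv_eq_one_div, div_le_div_iff₀ (by positivity) (by positivity)]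
  nlinarith [sq_nonneg ((n : ℝ) - 1 / 2)]

lemma inv_wt_le (hd : 1 ≤ d) {s : ℝ} (hs : 0 < s) (k : Fin d → ℤ) :
    (wt d s k)⁻¹ ≤ 2 ^ s * ∏ i, (1 + (k i : ℝ) ^ 2) ^ (-(s / d)) := by
  have hl := lam_cast_nonneg k
  have hd0 : (d : ℝ) ≠ 0 := by positivity
  have h1 : ∏ i, (1 + (k i : ℝ) ^ 2) ^ (s / d) ≤ (1 + (lam d k : ℝ)) ^ s := by
    calc ∏ i, (1 + (k i : ℝ) ^ 2) ^ (s / d) ≤ ∏ _i : Fin d, (1 + (lam d k : ℝ)) ^ (s / d) := by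
          refine Finset.prod_le_prod (fun i _ => by positivity) fun i _ => ?_
          have : (k i : ℝ) ^ 2 ≤ lam d k := by
            simp only [lam]
            exact_mod_cast Finset.single_le_sum (f := fun i => k i ^ 2)
              (fun _ _ => sq_nonneg _) (Finset.mem_univ i)
          gcongr
      _ = _ := by
          rw [Finset.prod_const, Finset.card_univ, Fintype.card_fin, ← Real.rpow_natCast,
            ← Real.rpow_mul (by positivity), div_mul_cancel₀ _ hd0]
  have h2 : (1 + (lam d k : ℝ)) ^ s ≤ 2 ^ s * wt d s k := by
    have h2s : (0 : ℝ) < 2 ^ s := by positivity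
    rcases le_total (lam d k : ℝ) 1 with h | h
    · calc (1 + (lam d k : ℝ)) ^ s ≤ 2 ^ s :=
            Real.rpow_le_rpow (by positivity) (by linarith) hs.le
        _ ≤ _ := le_mul_of_one_le_right h2s.le (one_le_wt s k)
    · calc (1 + (lam d k : ℝ)) ^ s ≤ (2 * lam d k) ^ s :=
            Real.rpow_le_rpow (by positivity) (by linarith) hs.le
        _ = 2 ^ s * (lam d k : ℝ) ^ s := Real.mul_rpow (by norm_num) hl
        _ ≤ _ := by gcongr; simp [wt]
  have hpos : 0 < ∏ i, (1 + (k i : ℝ) ^ 2) ^ (s / d) :=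
    Finset.prod_pos fun i _ => by positivity
  have hneg : ∏ i, (1 + (k i : ℝ) ^ 2) ^ (-(s / d)) = (∏ i, (1 + (k i : ℝ) ^ 2) ^ (s / d))⁻¹ := by
    rw [← Finset.prod_inv_distrib]
    exact Finset.prod_congr rfl fun i _ => Real.rpow_neg (by positivity) _
  have hw : 0 < wt d s k := zero_lt_one.trans_le (one_le_wt s k)
  rw [hneg, ← div_eq_mul_inv, le_div_iff₀ hpos, inv_mul_le_iff₀ hw]
  linarith

lemma tsum_inv_ewt_ne_top (hd : 1 ≤ d) {s : ℝ} (hs : (d : ℝ) / 2 < s) :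
    ∑' k, (ewt d s k)⁻¹ ≠ ∞ := by
  have hd0 : (0 : ℝ) < d := by exact_mod_cast hd
  have hs0 : 0 < s := by linarith
  have hr : 1 / 2 < s / d := by rw [lt_div_iff₀ hd0]; linarith
  have hle : ∀ k, (ewt d s k)⁻¹ ≤ ENNReal.ofReal (2 ^ s) *
      ∏ i, ENNReal.ofReal ((1 + (k i : ℝ) ^ 2) ^ (-(s / d))) := fun k => by
    rw [ewt, ← ENNReal.ofReal_inv_of_pos (zero_lt_one.trans_le (one_le_wt s k)),
      ← ENNReal.ofReal_prod_of_nonneg fun i _ => by positivity,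
      ← ENNReal.ofReal_mul (by positivity)]
    exact ENNReal.ofReal_le_ofReal (inv_wt_le hd hs0 k)
  refine ne_top_of_le_ne_top ?_ (ENNReal.tsum_le_tsum hle)
  rw [ENNReal.tsum_mul_left, ENNReal.tsum_prod_eq_prod_tsum
    (fun _ (n : ℤ) => ENNReal.ofReal ((1 + (n : ℝ) ^ 2) ^ (-(s / d))))]
  refine ENNReal.mul_ne_top ENNReal.ofReal_ne_top (ENNReal.prod_ne_top fun i _ => ?_)
  exact (summable_one_add_sq_rpow_neg hr).tsum_ofReal_ne_top

end Weights

section CauchySchwarz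

lemma lintegral_mul_sq_le {α : Type*} [MeasurableSpace α] (μ : Measure α) {f g : α → ℝ≥0∞}
    (hf : AEMeasurable f μ) (hg : AEMeasurable g μ) :
    (∫⁻ x, f x * g x ∂μ) ^ 2 ≤ (∫⁻ x, f x ^ 2 ∂μ) * ∫⁻ x, g x ^ 2 ∂μ := by
  have h := ENNReal.lintegral_mul_le_Lp_mul_Lq μ Real.HolderConjugate.two_two hf hg
  have h2 : ∀ x : ℝ≥0∞, (x ^ (1 / (2 : ℝ))) ^ 2 = x := fun x => by
    rw [← ENNReal.rpow_natCast, ← ENNReal.rpow_mul]; norm_num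
  calc (∫⁻ x, f x * g x ∂μ) ^ 2 ≤ _ := pow_le_pow_left' h 2
    _ = _ := by rw [mul_pow, h2, h2]; simp

lemma tsum_sq_le_tsum_inv_mul_tsum {α : Type*} (W f : α → ℝ≥0∞) (h0 : ∀ x, W x ≠ 0)
    (ht : ∀ x, W x ≠ ∞) : (∑' x, f x) ^ 2 ≤ (∑' x, (W x)⁻¹) * ∑' x, W x * f x ^ 2 := by
  let _ : MeasurableSpace α := ⊤
  have h := lintegral_mul_sq_le Measure.count (f := fun x => (W x)⁻¹ ^ (1 / (2 : ℝ)))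
    (g := fun x => W x ^ (1 / (2 : ℝ)) * f x) measurable_from_top.aemeasurable
    measurable_from_top.aemeasurable
  have h2 : ∀ x : ℝ≥0∞, (x ^ (1 / (2 : ℝ))) ^ 2 = x := fun x => by
    rw [← ENNReal.rpow_natCast, ← ENNReal.rpow_mul]; norm_num
  simp only [lintegral_count, mul_pow, h2] at h
  convert h using 4 with x
  rw [← mul_assoc, ← ENNReal.mul_rpow_of_nonneg _ _ (by norm_num), ENNReal.inv_mul_cancel (h0 x)
    (ht x), ENNReal.one_rpow, one_mul]

lemma lintegral_sq_le_lintegral_sq {α : Type*} [MeasurableSpace α] (μ : Measure α)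
    [IsProbabilityMeasure μ] {f : α → ℝ≥0∞} (hf : AEMeasurable f μ) :
    (∫⁻ x, f x ∂μ) ^ 2 ≤ ∫⁻ x, f x ^ 2 ∂μ := by
  simpa using lintegral_mul_sq_le μ hf (aemeasurable_const (b := 1))

end CauchySchwarz

section Algebra

variable {d : ℕ}

/-- The squared `h^s` norm of a sequence of extended nonnegative reals. -/
noncomputable def energy (d : ℕ) (s : ℝ) (f : (Fin d → ℤ) → ℝ≥0∞) : ℝ≥0∞ :=
  ∑' k, ewt d s k * f k ^ 2

/-- The sum of `∏ f(κ_j)` over all tuples `κ` with `∑ σ_j κ_j = k`. -/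
noncomputable def signedConv {N : ℕ} (σ : Fin N → ℤ) (f : (Fin d → ℤ) → ℝ≥0∞)
    (k : Fin d → ℤ) : ℝ≥0∞ :=
  ∑' κ : Fin N → (Fin d → ℤ), if ∑ j, σ j • κ j = k then ∏ j, f (κ j) else 0

/-- The constant in the algebra property of `h^s`. -/
noncomputable def algConst (d : ℕ) (s : ℝ) : ℝ≥0∞ :=
  2 * ENNReal.ofReal (4 ^ s) * ∑' k, (ewt d s k)⁻¹

lemma algConst_ne_top (hd : 1 ≤ d) {s : ℝ} (hs : (d : ℝ) / 2 < s) : algConst d s ≠ ∞ :=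
  ENNReal.mul_ne_top (ENNReal.mul_ne_top (by simp) ENNReal.ofReal_ne_top)
    (tsum_inv_ewt_ne_top hd hs)

lemma energy_mono {s : ℝ} {f g : (Fin d → ℤ) → ℝ≥0∞} (h : ∀ k, f k ≤ g k) :
    energy d s f ≤ energy d s g :=
  ENNReal.tsum_le_tsum fun k => by gcongr; exact h k

lemma energy_const_mul (s : ℝ) (c : ℝ≥0∞) (f : (Fin d → ℤ) → ℝ≥0∞) :
    energy d s (fun k => c * f k) = c ^ 2 * energy d s f := by
  simp only [energy, ← ENNReal.tsum_mul_left]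
  exact tsum_congr fun k => by ring

lemma ENNReal.add_sq_le (a b : ℝ≥0∞) : (a + b) ^ 2 ≤ 2 * (a ^ 2 + b ^ 2) := by
  have h := ENNReal.rpow_add_le_mul_rpow_add_rpow a b (p := 2) (by norm_num)
  norm_num at h
  exact h

lemma energy_add_le (s : ℝ) (f g : (Fin d → ℤ) → ℝ≥0∞) :
    energy d s (fun k => f k + g k) ≤ 2 * (energy d s f + energy d s g) := by
  simp only [energy, ← ENNReal.tsum_add, ← ENNReal.tsum_mul_left]
  refine ENNReal.tsum_le_tsum fun k => ?_
  calc ewt d s k * (f k + g k) ^ 2 ≤ ewt d s k * (2 * (f k ^ 2 + g k ^ 2)) := by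
        gcongr; exact ENNReal.add_sq_le _ _
    _ = _ := by ring

lemma tsum_ewt_mul_inv_le {s : ℝ} (hs : 0 ≤ s) {σ : ℤ} (hσ : σ ^ 2 = 1) (k : Fin d → ℤ) :
    ewt d s k * ∑' l, (ewt d s l * ewt d s (k - σ • l))⁻¹ ≤ algConst d s := by
  have hσ0 : σ ≠ 0 := by rintro rfl; simp at hσ
  have hterm : ∀ l, ewt d s k * (ewt d s l * ewt d s (k - σ • l))⁻¹ ≤
      ENNReal.ofReal (4 ^ s) * ((ewt d s (k - σ • l))⁻¹ + (ewt d s l)⁻¹) := fun l => by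
    have h := ewt_add_le hs (σ • l) (k - σ • l)
    rw [add_sub_cancel, ewt_smul_of_sq_eq_one hσ] at h
    have h1 := ENNReal.mul_inv_cancel (ewt_ne_zero s l) (ewt_ne_top s l)
    have h2 := ENNReal.mul_inv_cancel (ewt_ne_zero s (k - σ • l)) (ewt_ne_top s (k - σ • l))
    rw [ENNReal.mul_inv (.inl (ewt_ne_zero s l)) (.inl (ewt_ne_top s l))]
    calc _ ≤ ENNReal.ofReal (4 ^ s) * (ewt d s l + ewt d s (k - σ • l)) *
            ((ewt d s l)⁻¹ * (ewt d s (k - σ • l))⁻¹) := by gcongr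
      _ = ENNReal.ofReal (4 ^ s) * ((ewt d s l * (ewt d s l)⁻¹) * (ewt d s (k - σ • l))⁻¹ +
            (ewt d s (k - σ • l) * (ewt d s (k - σ • l))⁻¹) * (ewt d s l)⁻¹) := by ring
      _ = _ := by rw [h1, h2, one_mul, one_mul]
  have hinj : Function.Injective fun l : Fin d → ℤ => k - σ • l := fun x y h =>
    smul_right_injective _ hσ0 (sub_right_injective h)
  calc _ = ∑' l, ewt d s k * (ewt d s l * ewt d s (k - σ • l))⁻¹ := ENNReal.tsum_mul_left.symm
    _ ≤ _ := ENNReal.tsum_le_tsum hterm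
    _ = ENNReal.ofReal (4 ^ s) * (∑' l, (ewt d s (k - σ • l))⁻¹ + ∑' l, (ewt d s l)⁻¹) := by
        rw [ENNReal.tsum_mul_left, ENNReal.tsum_add]
    _ ≤ ENNReal.ofReal (4 ^ s) * (∑' l, (ewt d s l)⁻¹ + ∑' l, (ewt d s l)⁻¹) := by
        refine mul_le_mul_right (add_le_add_left ?_ _) _
        exact ENNReal.tsum_comp_le_tsum_of_injective hinj fun l => (ewt d s l)⁻¹
    _ = algConst d s := by rw [algConst]; ring

lemma energy_conv_le {s : ℝ} (hs : 0 ≤ s) {σ : ℤ} (hσ : σ ^ 2 = 1)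
    (f g : (Fin d → ℤ) → ℝ≥0∞) :
    energy d s (fun k => ∑' l, f l * g (k - σ • l)) ≤
      algConst d s * (energy d s f * energy d s g) := by
  calc energy d s (fun k => ∑' l, f l * g (k - σ • l))
      ≤ ∑' k, algConst d s *
          ∑' l, ewt d s l * f l ^ 2 * (ewt d s (k - σ • l) * g (k - σ • l) ^ 2) := by
        refine ENNReal.tsum_le_tsum fun k => ?_
        have h := tsum_sq_le_tsum_inv_mul_tsum (fun l => ewt d s l * ewt d s (k - σ • l))
          (fun l => f l * g (k - σ • l))
          (fun l => mul_ne_zero (ewt_ne_zero s _) (ewt_ne_zero s _))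
          (fun l => ENNReal.mul_ne_top (ewt_ne_top s _) (ewt_ne_top s _))
        calc _ ≤ ewt d s k * _ := by gcongr
          _ = _ := (mul_assoc _ _ _).symm
          _ ≤ _ := by
            refine mul_le_mul' (tsum_ewt_mul_inv_le hs hσ k)
              (ENNReal.tsum_le_tsum fun l => le_of_eq ?_)
            ring
    _ = algConst d s * ∑' l, ∑' k,
          ewt d s l * f l ^ 2 * (ewt d s (k - σ • l) * g (k - σ • l) ^ 2) := by
        rw [ENNReal.tsum_mul_left, ENNReal.tsum_comm]
    _ = algConst d s * ∑' l, ewt d s l * f l ^ 2 * energy d s g := by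
        congr 2 with l
        rw [ENNReal.tsum_mul_left, energy,
          ← (Equiv.subRight (σ • l)).tsum_eq fun k => ewt d s k * g k ^ 2]
        rfl
    _ = _ := by rw [ENNReal.tsum_mul_right]; rfl

lemma signedConv_succ {N : ℕ} (σ : Fin (N + 1) → ℤ) (f : (Fin d → ℤ) → ℝ≥0∞) (k : Fin d → ℤ) :
    signedConv σ f k =
      ∑' l, f l * signedConv (fun j => σ j.succ) f (k - σ 0 • l) := by
  rw [signedConv, ← (Fin.consEquiv fun _ => Fin d → ℤ).tsum_eq, ENNReal.tsum_prod']
  refine tsum_congr fun l => ?_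
  rw [signedConv, ← ENNReal.tsum_mul_left]
  refine tsum_congr fun κ => ?_
  simp only [Fin.consEquiv_apply, Fin.sum_univ_succ, Fin.prod_univ_succ, Fin.cons_zero,
    Fin.cons_succ, eq_sub_iff_add_eq', mul_ite, mul_zero]

lemma energy_signedConv_le {s : ℝ} (hs : 0 < s) {N : ℕ} {σ : Fin N → ℤ}
    (hσ : ∀ j, σ j ^ 2 = 1) (f : (Fin d → ℤ) → ℝ≥0∞) :
    energy d s (signedConv σ f) ≤ (algConst d s * energy d s f) ^ N := by
  induction N with
  | zero =>
    rw [energy, tsum_eq_single 0]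
    · simp [signedConv, ewt, wt, lam, Real.zero_rpow hs.ne']
    · intro k hk
      simp [signedConv, hk.symm]
  | succ N ih =>
    calc energy d s (signedConv σ f)
        = energy d s (fun k => ∑' l, f l * signedConv (fun j => σ j.succ) f (k - σ 0 • l)) := by
          congr 1; ext k; exact signedConv_succ σ f k
      _ ≤ _ := energy_conv_le hs.le (hσ 0) f _
      _ ≤ algConst d s * (energy d s f * (algConst d s * energy d s f) ^ N) := by
          gcongr; exact ih fun j => hσ j.succ
      _ = _ := by ring

lemma lt_top_of_energy_ne_top {s : ℝ} {f : (Fin d → ℤ) → ℝ≥0∞} (h : energy d s f ≠ ∞)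
    (k : Fin d → ℤ) : f k < ∞ := by
  have hk := ENNReal.ne_top_of_tsum_ne_top h k
  rw [lt_top_iff_ne_top]
  intro hf
  simp [hf, ENNReal.mul_top (ewt_ne_zero s k)] at hk

lemma energy_enorm_eq_ofReal (s : ℝ) {w : (Fin d → ℤ) → ℂ} (hw : memH d s w) :
    energy d s (fun k => ‖w k‖ₑ) = ENNReal.ofReal (hnorm d s w ^ 2) := by
  have h0 : ∀ k, 0 ≤ wt d s k * ‖w k‖ ^ 2 := fun k => mul_nonneg (wt_nonneg s k) (sq_nonneg _)
  rw [hnorm, Real.sq_sqrt (tsum_nonneg h0), ENNReal.ofReal_tsum_of_nonneg h0 hw, energy]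
  refine tsum_congr fun k => ?_
  rw [ENNReal.ofReal_mul (wt_nonneg s k), ENNReal.ofReal_pow (norm_nonneg _), ofReal_norm, ewt]

lemma hnorm_le_of_energy_le {s K : ℝ} (hK : 0 ≤ K) {w : (Fin d → ℤ) → ℂ}
    (h : energy d s (fun k => ‖w k‖ₑ) ≤ ENNReal.ofReal (K ^ 2)) : hnorm d s w ≤ K := by
  have h0 : ∀ k, 0 ≤ wt d s k * ‖w k‖ ^ 2 := fun k => mul_nonneg (wt_nonneg s k) (sq_nonneg _)
  by_cases hw : memH d s w
  · rw [energy_enorm_eq_ofReal s hw, ENNReal.ofReal_le_ofReal_iff (sq_nonneg K)] at h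
    exact (le_abs_self _).trans (abs_le_of_sq_le_sq h hK)
  · rw [hnorm, tsum_eq_zero_of_not_summable hw, Real.sqrt_zero]
    exact hK

lemma energy_le_two_mul_energy {s t : ℝ} (hs : 0 < s) (hst : s ≤ t) (f : (Fin d → ℤ) → ℝ≥0∞) :
    energy d s f ≤ 2 * energy d t f := by
  simp only [energy, ← ENNReal.tsum_mul_left, ← mul_assoc]
  refine ENNReal.tsum_le_tsum fun k => ?_
  gcongr
  rw [ewt, ewt, ← ENNReal.ofReal_ofNat 2, ← ENNReal.ofReal_mul zero_le_two]
  exact ENNReal.ofReal_le_ofReal (wt_le_two_mul_wt hs hst k)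

lemma energy_lintegral_le {α : Type*} [MeasurableSpace α] (ν : Measure α)
    [IsProbabilityMeasure ν] {s : ℝ} {f : α → (Fin d → ℤ) → ℝ≥0∞}
    (hf : ∀ k, AEMeasurable (fun x => f x k) ν) :
    energy d s (fun k => ∫⁻ x, f x k ∂ν) ≤ ∫⁻ x, energy d s (f x) ∂ν := by
  simp only [energy]
  rw [lintegral_tsum fun k => ((hf k).pow_const 2).const_mul _]
  refine ENNReal.tsum_le_tsum fun k => ?_
  rw [lintegral_const_mul' _ _ (ewt_ne_top s k)]
  gcongr
  exact lintegral_sq_le_lintegral_sq ν (hf k)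

end Algebra

section Calculus

lemma aestronglyMeasurable_of_hasDerivWithinAt {f f' : ℝ → ℂ} {a b : ℝ}
    (h : ∀ τ ∈ Icc a b, HasDerivWithinAt f (f' τ) (Icc a b) τ) :
    AEStronglyMeasurable f' (volume.restrict (Icc a b)) := by
  rw [← Measure.restrict_congr_set Ioo_ae_eq_Icc]
  refine (stronglyMeasurable_deriv f).aestronglyMeasurable.congr ?_
  filter_upwards [ae_restrict_mem measurableSet_Ioo] with τ hτ
  exact ((h τ (Ioo_subset_Icc_self hτ)).hasDerivAt (Icc_mem_nhds hτ.1 hτ.2)).deriv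

lemma norm_add_mul_integral_norm_le {v G : ℝ → ℂ} {γ ω : ℝ} (hγ : 0 ≤ γ)
    (hv : ∀ τ ∈ Icc (0 : ℝ) 1,
      HasDerivWithinAt v (Complex.I * ω * v τ - γ * v τ + G τ) (Icc 0 1) τ)
    (hG : IntegrableOn G (Icc 0 1)) {t : ℝ} (ht : t ∈ Icc (0 : ℝ) 1) :
    ‖v t‖ + γ * ∫ τ in (0 : ℝ)..t, ‖v τ‖ ≤ ‖v 0‖ + ∫ τ in (0 : ℝ)..t, ‖G τ‖ := by
  have hsub : Icc 0 t ⊆ Icc (0 : ℝ) 1 := Icc_subset_Icc_right ht.2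
  have hvc : ContinuousOn v (Icc 0 t) :=
    fun τ hτ => ((hv τ (hsub hτ)).continuousWithinAt).mono hsub
  have hvi : IntervalIntegrable (fun τ => ‖v τ‖) volume 0 t := by
    refine ContinuousOn.intervalIntegrable ?_
    rw [uIcc_of_le ht.1]
    exact hvc.norm
  have hGi : IntervalIntegrable (fun τ => ‖G τ‖) volume 0 t := by
    rw [intervalIntegrable_iff_integrableOn_Icc_of_le ht.1]
    exact (hG.mono_set hsub).norm
  have key : ∀ δ > 0, ‖v t‖ + γ * ∫ τ in (0 : ℝ)..t, ‖v τ‖ ≤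
      ‖v 0‖ + (∫ τ in (0 : ℝ)..t, ‖G τ‖) + δ * (1 + γ) := fun δ hδ => by
    set φ : ℝ → ℝ := fun τ => √(‖v τ‖ ^ 2 + δ ^ 2) with hφ
    have hpos : ∀ τ, 0 < ‖v τ‖ ^ 2 + δ ^ 2 := fun τ => by positivity
    have hle : ∀ τ, ‖v τ‖ ≤ φ τ := fun τ => Real.le_sqrt_of_sq_le (by nlinarith)
    have hleδ : ∀ τ, δ ≤ φ τ := fun τ => Real.le_sqrt_of_sq_le (by nlinarith [sq_nonneg ‖v τ‖])
    have hφsq : ∀ τ, φ τ ^ 2 = ‖v τ‖ ^ 2 + δ ^ 2 := fun τ => Real.sq_sqrt (hpos τ).le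
    have hφ0 : φ 0 ≤ ‖v 0‖ + δ :=
      Real.sqrt_le_iff.2 ⟨by positivity, by nlinarith [norm_nonneg (v 0)]⟩
    have hcont : ContinuousOn φ (Icc 0 t) := ((hvc.norm.pow 2).add continuousOn_const).sqrt
    have hint : IntegrableOn (fun τ => -γ * ‖v τ‖ + γ * δ + ‖G τ‖) (Icc 0 t) := by
      rw [← intervalIntegrable_iff_integrableOn_Icc_of_le ht.1]
      exact ((hvi.const_mul _).add intervalIntegrable_const).add hGi
    have hbound := intervalIntegral.sub_le_integral_of_hasDeriv_right_of_le ht.1 hcont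
      (g' := fun τ => (2 * inner ℝ (v τ) (Complex.I * ω * v τ - γ * v τ + G τ)) / (2 * φ τ))
      (fun τ hτ => by
        have hd := (hv τ (hsub (Ioo_subset_Icc_self hτ))).hasDerivAt
          (Icc_mem_nhds hτ.1 (hτ.2.trans_le ht.2))
        exact ((hd.norm_sq.add_const (δ ^ 2)).sqrt (hpos τ).ne').hasDerivWithinAt)
      hint (fun τ _ => by
        have hφpos : 0 < φ τ := hδ.trans_le (hleδ τ)
        have hinner : inner ℝ (v τ) (Complex.I * ω * v τ - γ * v τ + G τ) ≤
            -γ * ‖v τ‖ ^ 2 + ‖v τ‖ * ‖G τ‖ := by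
          have h1 : inner ℝ (v τ) (Complex.I * ω * v τ - γ * v τ) = -γ * ‖v τ‖ ^ 2 := by
            rw [← Complex.normSq_eq_norm_sq, Complex.inner, Complex.normSq_apply]
            simp
            ring
          rw [inner_add_right, h1]
          gcongr
          exact real_inner_le_norm _ _
        rw [mul_div_mul_left _ _ two_ne_zero, div_le_iff₀ hφpos]
        have h2 := mul_le_mul_of_nonneg_right (hle τ) (norm_nonneg (G τ))
        have h3 : γ * ‖v τ‖ * φ τ ≤ γ * (‖v τ‖ ^ 2 + δ * φ τ) := by
          rw [mul_assoc]
          gcongr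
          nlinarith [hle τ, hleδ τ, hφsq τ, norm_nonneg (v τ)]
        nlinarith)
    have hval : ∫ τ in (0 : ℝ)..t, (-γ * ‖v τ‖ + γ * δ + ‖G τ‖) =
        -γ * (∫ τ in (0 : ℝ)..t, ‖v τ‖) + t * (γ * δ) + ∫ τ in (0 : ℝ)..t, ‖G τ‖ := by
      rw [intervalIntegral.integral_add ((hvi.const_mul _).add intervalIntegrable_const) hGi,
        intervalIntegral.integral_add (hvi.const_mul _) intervalIntegrable_const,
        intervalIntegral.integral_const_mul, intervalIntegral.integral_const, sub_zero,
        smul_eq_mul]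
    rw [hval] at hbound
    have h4 : t * (γ * δ) ≤ γ * δ := mul_le_of_le_one_left (by positivity) ht.2
    linarith [hle t]
  refine le_of_forall_pos_le_add fun e he => ?_
  have h := key (e / (1 + γ)) (by positivity)
  rwa [div_mul_cancel₀ _ (by positivity)] at h

lemma norm_integral_exp_mul_le {g g' : ℝ → ℂ} {A B ω : ℝ} (hω : ω ≠ 0)
    {t : ℝ} (ht : 0 ≤ t)
    (hg : ∀ τ ∈ Icc 0 t, HasDerivWithinAt g (g' τ) (Icc 0 t) τ)
    (hg' : IntegrableOn g' (Icc 0 t)) (hA : ∀ τ ∈ Icc 0 t, ‖g τ‖ ≤ A)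
    (hB : ∫ τ in (0 : ℝ)..t, ‖g' τ‖ ≤ B) :
    ‖∫ τ in (0 : ℝ)..t, Complex.exp (Complex.I * (ω * τ : ℝ)) * g τ‖ ≤ |ω|⁻¹ * (2 * A + B) := by
  have hIω : Complex.I * (ω : ℂ) ≠ 0 := mul_ne_zero Complex.I_ne_zero (by exact_mod_cast hω)
  set E : ℝ → ℂ := fun τ => Complex.exp (Complex.I * (ω * τ : ℝ)) / (Complex.I * ω) with hE
  have hnorm1 : ∀ τ : ℝ, ‖Complex.exp (Complex.I * (ω * τ : ℝ))‖ = 1 := fun τ => by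
    rw [mul_comm]; exact Complex.norm_exp_ofReal_mul_I _
  have hEnorm : ∀ τ, ‖E τ‖ = |ω|⁻¹ := fun τ => by
    rw [hE]; simp only [norm_div, hnorm1]; simp
  have hEd : ∀ τ : ℝ, HasDerivAt E (Complex.exp (Complex.I * (ω * τ : ℝ))) τ := fun τ => by
    have h1 : HasDerivAt (fun τ : ℝ => Complex.I * ((ω * τ : ℝ) : ℂ)) (Complex.I * ω) τ := by
      have := ((hasDerivAt_id τ).const_mul ω).ofReal_comp.const_mul Complex.I
      simpa using this
    have h2 := h1.cexp.div_const (Complex.I * (ω : ℂ))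
    rwa [mul_div_cancel_right₀ _ hIω] at h2
  have hgc : ContinuousOn g (Icc 0 t) := fun τ hτ => (hg τ hτ).continuousWithinAt
  have hEc : Continuous E := continuous_iff_continuousAt.2 fun τ => (hEd τ).continuousAt
  have hec : Continuous fun τ : ℝ => Complex.exp (Complex.I * (ω * τ : ℝ)) := by fun_prop
  have hgi' : IntervalIntegrable g' volume 0 t := by
    rwa [intervalIntegrable_iff_integrableOn_Icc_of_le ht]
  have hi1 : IntervalIntegrable (fun τ => Complex.exp (Complex.I * (ω * τ : ℝ)) * g τ)
      volume 0 t := by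
    refine ContinuousOn.intervalIntegrable ?_
    rw [uIcc_of_le ht]
    exact hec.continuousOn.mul hgc
  have hi2 : IntervalIntegrable (fun τ => E τ * g' τ) volume 0 t :=
    hgi'.continuousOn_mul hEc.continuousOn
  have hftc := intervalIntegral.integral_eq_sub_of_hasDerivAt_of_le ht
    (hEc.continuousOn.mul hgc) (fun τ hτ => (hEd τ).mul ((hg τ (Ioo_subset_Icc_self hτ)).hasDerivAt
      (Icc_mem_nhds hτ.1 hτ.2))) (hi1.add hi2)
  rw [intervalIntegral.integral_add hi1 hi2, ← eq_sub_iff_add_eq] at hftc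
  rw [hftc]
  have h0 : ‖E 0 * g 0‖ ≤ |ω|⁻¹ * A := by
    rw [norm_mul, hEnorm]; gcongr; exact hA 0 (left_mem_Icc.2 ht)
  have h1 : ‖E t * g t‖ ≤ |ω|⁻¹ * A := by
    rw [norm_mul, hEnorm]; gcongr; exact hA t (right_mem_Icc.2 ht)
  have h2 : ‖∫ τ in (0 : ℝ)..t, E τ * g' τ‖ ≤ |ω|⁻¹ * B := by
    refine (intervalIntegral.norm_integral_le_integral_norm ht).trans ?_
    simp only [norm_mul, hEnorm, intervalIntegral.integral_const_mul]
    gcongr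
  calc _ ≤ ‖E t * g t‖ + ‖E 0 * g 0‖ + ‖∫ τ in (0 : ℝ)..t, E τ * g' τ‖ :=
        (norm_sub_le _ _).trans (by gcongr; exact norm_sub_le _ _)
    _ ≤ _ := by linarith

lemma norm_integral_exp_mul_prod_le {ι : Type*} [Fintype ι] {f f' : ι → ℝ → ℂ} {A : ι → ℝ}
    {ω : ℝ} (hω : ω ≠ 0) {t : ℝ} (ht : 0 ≤ t)
    (hf : ∀ i, ∀ τ ∈ Icc 0 t, HasDerivWithinAt (f i) (f' i τ) (Icc 0 t) τ)
    (hf' : ∀ i, IntegrableOn (f' i) (Icc 0 t)) (hA : ∀ i, ∀ τ ∈ Icc 0 t, ‖f i τ‖ ≤ A i)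
    (hB : ∀ i, ∫ τ in (0 : ℝ)..t, ‖f' i τ‖ ≤ 2 * A i) :
    ‖∫ τ in (0 : ℝ)..t, Complex.exp (Complex.I * (ω * τ : ℝ)) * ∏ i, f i τ‖ ≤
      |ω|⁻¹ * ((2 + 2 * Fintype.card ι) * ∏ i, A i) := by
  classical
  have hA0 : ∀ i, 0 ≤ A i := fun i => (norm_nonneg _).trans (hA i 0 (left_mem_Icc.2 ht))
  have hfc : ∀ i, ContinuousOn (f i) (Icc 0 t) := fun i τ hτ => (hf i τ hτ).continuousWithinAt
  have hprodc : ∀ S : Finset ι, ContinuousOn (fun τ => ∏ j ∈ S, f j τ) (Icc 0 t) :=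
    fun S => continuousOn_finsetProd S fun i _ => hfc i
  have hi : ∀ i, IntegrableOn (fun τ => (∏ j ∈ Finset.univ.erase i, f j τ) • f' i τ)
      (Icc 0 t) := fun i => (hf' i).continuousOn_mul (hprodc _) isCompact_Icc
  have hii : ∀ i, IntervalIntegrable (fun τ => ‖(∏ j ∈ Finset.univ.erase i, f j τ) • f' i τ‖)
      volume 0 t := fun i => by
    rw [intervalIntegrable_iff_integrableOn_Icc_of_le ht]
    exact (hi i).norm
  have hterm : ∀ i, ∫ τ in (0 : ℝ)..t, ‖(∏ j ∈ Finset.univ.erase i, f j τ) • f' i τ‖ ≤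
      2 * ∏ j, A j := fun i => by
    have hi' : IntervalIntegrable (fun τ => ‖f' i τ‖) volume 0 t := by
      rw [intervalIntegrable_iff_integrableOn_Icc_of_le ht]
      exact (hf' i).norm
    calc _ ≤ ∫ τ in (0 : ℝ)..t, (∏ j ∈ Finset.univ.erase i, A j) * ‖f' i τ‖ := by
          refine intervalIntegral.integral_mono_on ht (hii i) (hi'.const_mul _) fun τ hτ => ?_
          rw [norm_smul, norm_prod]
          gcongr with j
          exact hA j τ hτ
      _ ≤ (∏ j ∈ Finset.univ.erase i, A j) * (2 * A i) := by
          rw [intervalIntegral.integral_const_mul]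
          exact mul_le_mul_of_nonneg_left (hB i) (Finset.prod_nonneg fun j _ => hA0 j)
      _ = 2 * ∏ j, A j := by
          rw [← Finset.prod_erase_mul _ _ (Finset.mem_univ i)]; ring
  refine (norm_integral_exp_mul_le (A := ∏ i, A i) (B := Fintype.card ι * (2 * ∏ i, A i)) hω ht
    (fun τ hτ => HasDerivWithinAt.fun_finsetProd fun i _ => hf i τ hτ)
    (integrable_finsetSum _ fun i _ => hi i) (fun τ hτ => ?_) ?_).trans_eq (by ring)
  · rw [norm_prod]
    exact Finset.prod_le_prod (fun i _ => norm_nonneg _) fun i _ => hA i τ hτ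
  · calc _ ≤ ∫ τ in (0 : ℝ)..t, ∑ i, ‖(∏ j ∈ Finset.univ.erase i, f j τ) • f' i τ‖ := by
          refine intervalIntegral.integral_mono_on ht ?_ ?_ fun τ _ => norm_sum_le _ _
          · rw [intervalIntegrable_iff_integrableOn_Icc_of_le ht]
            exact (integrable_finsetSum _ fun i _ => hi i).norm
          · rw [intervalIntegrable_iff_integrableOn_Icc_of_le ht]
            exact integrable_finsetSum _ fun i _ => (hi i).norm
      _ = ∑ i, ∫ τ in (0 : ℝ)..t, ‖(∏ j ∈ Finset.univ.erase i, f j τ) • f' i τ‖ :=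
          intervalIntegral.integral_finsetSum fun i _ => hii i
      _ ≤ ∑ _i : ι, 2 * ∏ j, A j := Finset.sum_le_sum fun i _ => hterm i
      _ = _ := by simp

end Calculus

section Nonlinearity

variable {d n : ℕ}

/-- The alternating signs `(-1)^j` in the definition of `S(k,n)`. -/
def altSign (n : ℕ) (j : Fin (2 * n + 1)) : ℤ := (-1) ^ (j : ℕ)

lemma altSign_sq (j : Fin (2 * n + 1)) : altSign n j ^ 2 = 1 := by
  rw [altSign, ← pow_mul, mul_comm, pow_mul]; simp

lemma altSign_of_even {j : Fin (2 * n + 1)} (h : Even (j : ℕ)) : altSign n j = 1 :=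
  Even.neg_one_pow h

lemma altSign_of_not_even {j : Fin (2 * n + 1)} (h : ¬ Even (j : ℕ)) : altSign n j = -1 :=
  Odd.neg_one_pow (Nat.not_even_iff_odd.1 h)

/-- The monomial `w_{κ₁} conj(w_{κ₂}) ⋯ w_{κ_{2n+1}}`. -/
noncomputable def monomialAt (w : (Fin d → ℤ) → ℂ) (κ : Fin (2 * n + 1) → (Fin d → ℤ)) : ℂ :=
  ∏ j : Fin (2 * n + 1), (if Even (j : ℕ) then w (κ j) else (starRingEnd ℂ) (w (κ j)))

lemma Pterm_eq (w : (Fin d → ℤ) → ℂ) (k : Fin d → ℤ) (κ : Fin (2 * n + 1) → (Fin d → ℤ)) :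
    Pterm d n w k κ = if ∑ j, altSign n j • κ j = k then monomialAt w κ else 0 := rfl

lemma Rterm_eq (w : (Fin d → ℤ) → ℂ) (k : Fin d → ℤ) (κ : Fin (2 * n + 1) → (Fin d → ℤ)) :
    Rterm d n w k κ = if ∑ j, altSign n j • κ j = k ∧ ∑ j, altSign n j * lam d (κ j) = lam d k
      then monomialAt w κ else 0 := rfl

lemma norm_monomialAt (w : (Fin d → ℤ) → ℂ) (κ : Fin (2 * n + 1) → (Fin d → ℤ)) :
    ‖monomialAt w κ‖ = ∏ j, ‖w (κ j)‖ := by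
  rw [monomialAt, norm_prod]
  refine Finset.prod_congr rfl fun j _ => ?_
  split_ifs
  · rfl
  · exact RCLike.norm_conj _

lemma enorm_Pterm (w : (Fin d → ℤ) → ℂ) (k : Fin d → ℤ) (κ : Fin (2 * n + 1) → (Fin d → ℤ)) :
    ‖Pterm d n w k κ‖ₑ = if ∑ j, altSign n j • κ j = k then ∏ j, ‖w (κ j)‖ₑ else 0 := by
  rw [Pterm_eq]
  split_ifs
  · rw [← ofReal_norm, norm_monomialAt, ENNReal.ofReal_prod_of_nonneg fun _ _ => norm_nonneg _]
    simp only [ofReal_norm]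
  · exact enorm_zero

lemma enorm_Pk_le (w : (Fin d → ℤ) → ℂ) (k : Fin d → ℤ) :
    ‖Pk d n w k‖ₑ ≤ signedConv (altSign n) (fun l => ‖w l‖ₑ) k :=
  enorm_tsum_le_tsum_enorm.trans_eq (tsum_congr fun κ => enorm_Pterm w k κ)

lemma monomialAt_phase (w : (Fin d → ℤ) → ℂ) (θ : (Fin d → ℤ) → ℝ)
    (κ : Fin (2 * n + 1) → (Fin d → ℤ)) :
    monomialAt (fun l => Complex.exp (Complex.I * θ l) * w l) κ =
      Complex.exp (Complex.I * (∑ j, altSign n j * θ (κ j) : ℝ)) * monomialAt w κ := by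
  rw [monomialAt, monomialAt, Complex.ofReal_sum, Finset.mul_sum, Complex.exp_sum,
    ← Finset.prod_mul_distrib]
  refine Finset.prod_congr rfl fun j _ => ?_
  split_ifs with h
  · simp [altSign_of_even h]
  · rw [map_mul, ← Complex.exp_conj]
    simp [altSign_of_not_even h]

/-- The factor multiplying `τ` in the phase of the monomial at `κ`. -/
noncomputable def phaseRate (ε : ℝ) (k : Fin d → ℤ) (κ : Fin (2 * n + 1) → (Fin d → ℤ)) : ℝ :=
  ε⁻¹ * ((∑ j, altSign n j * lam d (κ j) - lam d k : ℤ) : ℝ)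

lemma inv_abs_phaseRate_le {ε : ℝ} (hε : 0 < ε) {k : Fin d → ℤ}
    {κ : Fin (2 * n + 1) → (Fin d → ℤ)} (h : ∑ j, altSign n j * lam d (κ j) ≠ lam d k) :
    phaseRate ε k κ ≠ 0 ∧ |phaseRate ε k κ|⁻¹ ≤ ε := by
  have h1 := Int.one_le_abs (sub_ne_zero.2 h)
  have h2 : (1 : ℝ) ≤ |((∑ j, altSign n j * lam d (κ j) - lam d k : ℤ) : ℝ)| := by
    exact_mod_cast h1
  refine ⟨mul_ne_zero (inv_ne_zero hε.ne') (by exact_mod_cast sub_ne_zero.2 h), ?_⟩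
  rw [phaseRate, abs_mul, abs_inv, abs_of_pos hε, mul_inv, inv_inv]
  exact mul_le_of_le_one_right hε.le (inv_le_one_of_one_le₀ h2)

lemma Pterm_sub_Rterm_eq (ε τ : ℝ) (w : (Fin d → ℤ) → ℂ) (k : Fin d → ℤ)
    (κ : Fin (2 * n + 1) → (Fin d → ℤ)) :
    Complex.exp (-Complex.I * ((ε : ℂ))⁻¹ * (lam d k : ℂ) * (τ : ℂ)) *
        Pterm d n (fun l => Complex.exp (Complex.I * ((ε : ℂ))⁻¹ * (lam d l : ℂ) * (τ : ℂ)) * w l)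
          k κ - Rterm d n w k κ =
      if ∑ j, altSign n j • κ j = k ∧ ∑ j, altSign n j * lam d (κ j) ≠ lam d k then
        Complex.exp (Complex.I * (phaseRate ε k κ * τ : ℝ)) * monomialAt w κ else 0 := by
  have hphase : (fun l => Complex.exp (Complex.I * ((ε : ℂ))⁻¹ * (lam d l : ℂ) * (τ : ℂ)) * w l) =
      fun l => Complex.exp (Complex.I * ((ε⁻¹ * lam d l * τ : ℝ) : ℂ)) * w l := by
    ext l; congr 2; push_cast; ring
  have hcomb : Complex.exp (-Complex.I * ((ε : ℂ))⁻¹ * (lam d k : ℂ) * (τ : ℂ)) *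
      (Complex.exp (Complex.I * (∑ j, altSign n j * (ε⁻¹ * lam d (κ j) * τ) : ℝ)) *
        monomialAt w κ) =
      Complex.exp (Complex.I * (phaseRate ε k κ * τ : ℝ)) * monomialAt w κ := by
    rw [← mul_assoc, ← Complex.exp_add]
    congr 2
    have hsum : ∑ j, (altSign n j : ℝ) * (ε⁻¹ * lam d (κ j) * τ) =
        ε⁻¹ * (∑ j, (altSign n j : ℝ) * lam d (κ j)) * τ := by
      rw [Finset.mul_sum, Finset.sum_mul]
      exact Finset.sum_congr rfl fun j _ => by ring
    rw [hsum, phaseRate]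
    push_cast
    ring
  rw [Pterm_eq, Rterm_eq, hphase, monomialAt_phase w fun l => ε⁻¹ * lam d l * τ]
  by_cases hS : ∑ j, altSign n j • κ j = k
  · by_cases hR : ∑ j, altSign n j * lam d (κ j) = lam d k
    · simp only [hS, hR, true_and, if_true, ne_eq, not_true_eq_false, if_false]
      rw [hcomb, phaseRate, hR]
      simp
    · simp only [hS, hR, true_and, if_true, ne_eq, not_false_eq_true, if_false, sub_zero]
      exact hcomb
  · simp only [hS, false_and, if_false, mul_zero, sub_zero]

lemma integral_Pk_sub_Rk {ε : ℝ} (hε : 0 < ε) {a a' : ℝ → (Fin d → ℤ) → ℂ}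
    {A : (Fin d → ℤ) → ℝ}
    (ha : ∀ l, ∀ τ ∈ Icc (0 : ℝ) 1, HasDerivWithinAt (fun t => a t l) (a' τ l) (Icc 0 1) τ)
    (hai : ∀ l, IntegrableOn (fun τ => a' τ l) (Icc 0 1))
    (hA : ∀ l, ∀ τ ∈ Icc (0 : ℝ) 1, ‖a τ l‖ ≤ A l)
    (hB : ∀ l, ∀ t ∈ Icc (0 : ℝ) 1, ∫ τ in (0 : ℝ)..t, ‖a' τ l‖ ≤ 2 * A l)
    {t : ℝ} (ht : t ∈ Icc (0 : ℝ) 1) {k : Fin d → ℤ}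
    (hfin : signedConv (altSign n) (fun l => ENNReal.ofReal (A l)) k ≠ ∞) :
    IntervalIntegrable (fun τ : ℝ =>
      Complex.exp (-Complex.I * ((ε : ℂ))⁻¹ * (lam d k : ℂ) * (τ : ℂ)) *
        Pk d n (fun l => Complex.exp (Complex.I * ((ε : ℂ))⁻¹ * (lam d l : ℂ) * (τ : ℂ)) * a τ l) k
        - Rk d n (a τ) k) volume 0 t ∧
    ‖∫ τ in (0 : ℝ)..t,
      (Complex.exp (-Complex.I * ((ε : ℂ))⁻¹ * (lam d k : ℂ) * (τ : ℂ)) *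
        Pk d n (fun l => Complex.exp (Complex.I * ((ε : ℂ))⁻¹ * (lam d l : ℂ) * (τ : ℂ)) * a τ l) k
        - Rk d n (a τ) k)‖ₑ ≤
      ENNReal.ofReal (ε * (4 * n + 4)) *
        signedConv (altSign n) (fun l => ENNReal.ofReal (A l)) k := by
  have hsub : Icc 0 t ⊆ Icc (0 : ℝ) 1 := Icc_subset_Icc_right ht.2
  have hA0 : ∀ l, 0 ≤ A l := fun l => (norm_nonneg _).trans (hA l 0 (by simp))
  set D : (Fin (2 * n + 1) → (Fin d → ℤ)) → ℝ → ℂ := fun κ τ =>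
    if ∑ j, altSign n j • κ j = k ∧ ∑ j, altSign n j * lam d (κ j) ≠ lam d k then
      Complex.exp (Complex.I * (phaseRate ε k κ * τ : ℝ)) * monomialAt (a τ) κ else 0 with hD
  set bd : (Fin (2 * n + 1) → (Fin d → ℤ)) → ℝ := fun κ =>
    if ∑ j, altSign n j • κ j = k then ∏ j, A (κ j) else 0 with hbd
  have hprod0 : ∀ κ : Fin (2 * n + 1) → (Fin d → ℤ), 0 ≤ ∏ j, A (κ j) :=
    fun κ => Finset.prod_nonneg fun j _ => hA0 _
  have hbd0 : ∀ κ, 0 ≤ bd κ := fun κ => by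
    simp only [hbd]; split_ifs
    · exact hprod0 κ
    · exact le_rfl
  have hbdE : ∀ κ, ENNReal.ofReal (bd κ) =
      if ∑ j, altSign n j • κ j = k then ∏ j, ENNReal.ofReal (A (κ j)) else 0 := fun κ => by
    simp only [hbd]; split_ifs
    · exact ENNReal.ofReal_prod_of_nonneg fun j _ => hA0 _
    · exact ENNReal.ofReal_zero
  have hsum : Summable bd := by
    refine (ENNReal.summable_toReal hfin).congr fun κ => ?_
    rw [← hbdE, ENNReal.toReal_ofReal (hbd0 κ)]
  have hexp : ∀ x : ℝ, ‖Complex.exp (Complex.I * (x : ℂ))‖ = 1 := fun x => by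
    rw [mul_comm]; exact Complex.norm_exp_ofReal_mul_I x
  have hmon : ∀ w : (Fin d → ℤ) → ℂ, (∀ l, ‖w l‖ ≤ A l) →
      ∀ κ : Fin (2 * n + 1) → (Fin d → ℤ), ‖monomialAt w κ‖ ≤ ∏ j, A (κ j) := fun w hw κ => by
    rw [norm_monomialAt]
    exact Finset.prod_le_prod (fun _ _ => norm_nonneg _) fun j _ => hw _
  have hDle : ∀ κ, ∀ τ ∈ Icc (0 : ℝ) 1, ‖D κ τ‖ ≤ bd κ := fun κ τ hτ => by
    by_cases h : ∑ j, altSign n j • κ j = k ∧ ∑ j, altSign n j * lam d (κ j) ≠ lam d k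
    · simp only [hD, hbd, if_pos h, if_pos h.1, norm_mul, hexp, one_mul]
      exact hmon _ (fun l => hA l τ hτ) κ
    · simp only [hD, if_neg h, norm_zero, hbd0]
  have hPsum : ∀ w : (Fin d → ℤ) → ℂ, (∀ l, ‖w l‖ ≤ A l) → Summable (Pterm d n w k) :=
    fun w hw => hsum.of_norm_bounded fun κ => by
      rw [Pterm_eq]; simp only [hbd]; split_ifs
      · exact hmon w hw κ
      · simp
  have hRsum : ∀ w : (Fin d → ℤ) → ℂ, (∀ l, ‖w l‖ ≤ A l) → Summable (Rterm d n w k) :=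
    fun w hw => hsum.of_norm_bounded fun κ => by
      rw [Rterm_eq]
      split_ifs with h
      · simp only [hbd, if_pos h.1]; exact hmon w hw κ
      · simpa using hbd0 κ
  have hHas : ∀ τ ∈ Icc (0 : ℝ) 1, HasSum (fun κ => D κ τ)
      (Complex.exp (-Complex.I * ((ε : ℂ))⁻¹ * (lam d k : ℂ) * (τ : ℂ)) *
        Pk d n (fun l => Complex.exp (Complex.I * ((ε : ℂ))⁻¹ * (lam d l : ℂ) * (τ : ℂ)) * a τ l) k
        - Rk d n (a τ) k) := fun τ hτ => by
    have hw : ∀ l, ‖Complex.exp (Complex.I * ((ε : ℂ))⁻¹ * (lam d l : ℂ) * (τ : ℂ)) * a τ l‖ ≤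
        A l := fun l => by
      have : Complex.I * ((ε : ℂ))⁻¹ * (lam d l : ℂ) * (τ : ℂ) =
          Complex.I * ((ε⁻¹ * lam d l * τ : ℝ) : ℂ) := by push_cast; ring
      rw [norm_mul, this, hexp, one_mul]
      exact hA l τ hτ
    have h := ((hPsum _ hw).hasSum.mul_left
      (Complex.exp (-Complex.I * ((ε : ℂ))⁻¹ * (lam d k : ℂ) * (τ : ℂ)))).sub
      (hRsum _ fun l => hA l τ hτ).hasSum
    simp only [Pterm_sub_Rterm_eq] at h
    exact h
  have hac : ∀ l, ContinuousOn (fun τ => a τ l) (Icc 0 1) :=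
    fun l τ hτ => (ha l τ hτ).continuousWithinAt
  have hfac : ∀ κ : Fin (2 * n + 1) → (Fin d → ℤ), ∀ j : Fin (2 * n + 1), ∀ τ ∈ Icc (0 : ℝ) 1,
      HasDerivWithinAt
        (fun τ => if Even (j : ℕ) then a τ (κ j) else (starRingEnd ℂ) (a τ (κ j)))
        (if Even (j : ℕ) then a' τ (κ j) else (starRingEnd ℂ) (a' τ (κ j))) (Icc 0 1) τ :=
    fun κ j τ hτ => by
      split_ifs
      · exact ha _ τ hτ
      · exact (ha _ τ hτ).star
  have hmonc : ∀ κ : Fin (2 * n + 1) → (Fin d → ℤ),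
      ContinuousOn (fun τ => monomialAt (a τ) κ) (Icc 0 1) := fun κ =>
    continuousOn_finsetProd _ fun j _ τ hτ => (hfac κ j τ hτ).continuousWithinAt
  have hDc : ∀ κ, ContinuousOn (D κ) (Icc 0 1) := fun κ => by
    by_cases h : ∑ j, altSign n j • κ j = k ∧ ∑ j, altSign n j * lam d (κ j) ≠ lam d k
    · simp only [hD, if_pos h]
      exact ContinuousOn.mul (by fun_prop) (hmonc κ)
    · simp only [hD, if_neg h]
      exact continuousOn_const
  have hIoc : Ioc 0 t ⊆ Icc (0 : ℝ) 1 := Ioc_subset_Icc_self.trans hsub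
  have hDm : ∀ κ, AEStronglyMeasurable (D κ) (volume.restrict (Ioc 0 t)) := fun κ =>
    ((hDc κ).mono hIoc).aestronglyMeasurable measurableSet_Ioc
  have hDint : ∀ κ, ‖∫ τ in (0 : ℝ)..t, D κ τ‖ ≤ ε * (4 * n + 4) * bd κ := fun κ => by
    by_cases h : ∑ j, altSign n j • κ j = k ∧ ∑ j, altSign n j * lam d (κ j) ≠ lam d k
    · obtain ⟨hω, hωle⟩ := inv_abs_phaseRate_le hε h.2
      simp only [hD, hbd, if_pos h, if_pos h.1]
      refine (norm_integral_exp_mul_prod_le (A := fun j => A (κ j)) hω ht.1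
        (fun j τ hτ => (hfac κ j τ (hsub hτ)).mono hsub) (fun j => ?_) (fun j τ hτ => ?_)
        fun j => ?_).trans ?_
      · split_ifs
        · exact (hai _).mono_set hsub
        · exact (Complex.conjCLE : ℂ →L[ℝ] ℂ).integrable_comp ((hai _).mono_set hsub)
      · split_ifs
        · exact hA _ τ (hsub hτ)
        · exact (RCLike.norm_conj _).trans_le (hA _ τ (hsub hτ))
      · split_ifs
        · exact hB _ t ht
        · simpa only [RCLike.norm_conj] using hB _ t ht
      · rw [Fintype.card_fin, mul_assoc]
        push_cast
        have := hprod0 κ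
        calc _ ≤ ε * ((2 + 2 * (2 * n + 1)) * ∏ j, A (κ j)) := by gcongr
          _ = _ := by ring
    · simp only [hD, if_neg h, intervalIntegral.integral_zero, norm_zero]
      exact mul_nonneg (by positivity) (hbd0 κ)
  constructor
  · rw [intervalIntegrable_iff_integrableOn_Ioc_of_le ht.1]
    refine Integrable.of_bound ?_ (∑' κ, bd κ) ?_
    · refine aestronglyMeasurable_of_tendsto_ae Filter.atTop
        (f := fun (S : Finset (Fin (2 * n + 1) → (Fin d → ℤ))) τ => ∑ κ ∈ S, D κ τ)
        (fun S => Finset.aestronglyMeasurable_fun_sum S fun κ _ => hDm κ) ?_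
      filter_upwards [ae_restrict_mem measurableSet_Ioc] with τ hτ
      exact hHas τ (hIoc hτ)
    · filter_upwards [ae_restrict_mem measurableSet_Ioc] with τ hτ
      rw [← (hHas τ (hIoc hτ)).tsum_eq]
      exact tsum_of_norm_bounded hsum.hasSum fun κ => hDle κ τ (hIoc hτ)
  · have hint := intervalIntegral.hasSum_integral_of_dominated_convergence (μ := volume)
      (a := 0) (b := t) (fun κ _ => bd κ) (by rwa [uIoc_of_le ht.1])
      (fun κ => by
        filter_upwards with τ hτ
        rw [uIoc_of_le ht.1] at hτ
        exact hDle κ τ (hIoc hτ))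
      (by filter_upwards with τ _ using hsum) intervalIntegrable_const
      (by
        filter_upwards with τ hτ
        rw [uIoc_of_le ht.1] at hτ
        exact hHas τ (hIoc hτ))
    rw [← hint.tsum_eq, signedConv, ← ENNReal.tsum_mul_left]
    refine enorm_tsum_le_tsum_enorm.trans (ENNReal.tsum_le_tsum fun κ => ?_)
    rw [← hbdE, ← ENNReal.ofReal_mul (by positivity), ← ofReal_norm]
    exact ENNReal.ofReal_le_ofReal (hDint κ)

end Nonlinearity

section Assembly

variable {d : ℕ}

lemma energy_add_signedConv_le {s : ℝ} (hs : 0 < s) (p q : ℕ) (β γ : ℝ≥0∞) {E : ℝ≥0∞}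
    {f : (Fin d → ℤ) → ℝ≥0∞} (hf : energy d s f ≤ E) :
    energy d s (fun k => β * signedConv (altSign p) f k + γ * signedConv (altSign q) f k) ≤
      2 * (β ^ 2 * (algConst d s * E) ^ (2 * p + 1) + γ ^ 2 * (algConst d s * E) ^ (2 * q + 1)) := by
  refine (energy_add_le s _ _).trans ?_
  rw [energy_const_mul, energy_const_mul]
  gcongr
  · exact (energy_signedConv_le hs altSign_sq f).trans (by gcongr)
  · exact (energy_signedConv_le hs altSign_sq f).trans (by gcongr)

lemma enorm_add_Pk_le (p q : ℕ) (b c : ℂ) (w : (Fin d → ℤ) → ℂ) (k : Fin d → ℤ) :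
    ‖b * Pk d p w k + Complex.I * c * Pk d q w k‖ₑ ≤
      ‖b‖ₑ * signedConv (altSign p) (fun l => ‖w l‖ₑ) k +
        ‖c‖ₑ * signedConv (altSign q) (fun l => ‖w l‖ₑ) k := by
  refine (enorm_add_le _ _).trans ?_
  rw [enorm_mul, enorm_mul, enorm_mul, ← ofReal_norm Complex.I, Complex.norm_I, ENNReal.ofReal_one,
    one_mul]
  gcongr <;> exact enorm_Pk_le _ _

end Assembly

section Dissipation

lemma hasDerivWithinAt_interaction {v G : ℝ → ℂ} {γ ω τ : ℝ} {S : Set ℝ}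
    (hv : HasDerivWithinAt v (Complex.I * ω * v τ - γ * v τ + G τ) S τ) :
    HasDerivWithinAt (fun t : ℝ => Complex.exp (-Complex.I * ω * t) * v t)
      (Complex.exp (-Complex.I * ω * τ) * (-γ * v τ + G τ)) S τ := by
  have h1 : HasDerivAt (fun t : ℝ => -Complex.I * ω * (t : ℂ)) (-Complex.I * ω) τ := by
    simpa using (hasDerivAt_id τ).ofReal_comp.const_mul (-Complex.I * (ω : ℂ))
  refine (h1.cexp.hasDerivWithinAt.mul hv).congr_deriv ?_
  ring

lemma norm_exp_neg_I_mul (ω τ : ℝ) : ‖Complex.exp (-Complex.I * ω * τ)‖ = 1 := by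
  have : -Complex.I * (ω : ℂ) * τ = ((-(ω * τ) : ℝ) : ℂ) * Complex.I := by push_cast; ring
  rw [this, Complex.norm_exp_ofReal_mul_I]

lemma aestronglyMeasurable_forcing {v G : ℝ → ℂ} {γ ω : ℝ}
    (hv : ∀ τ ∈ Icc (0 : ℝ) 1,
      HasDerivWithinAt v (Complex.I * ω * v τ - γ * v τ + G τ) (Icc 0 1) τ) :
    AEStronglyMeasurable G (volume.restrict (Icc 0 1)) := by
  have hvc : ContinuousOn v (Icc 0 1) := fun τ hτ => (hv τ hτ).continuousWithinAt
  have h1 := aestronglyMeasurable_of_hasDerivWithinAt hv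
  have h2 : ContinuousOn (fun τ => Complex.I * ω * v τ - γ * v τ) (Icc 0 1) := by fun_prop
  refine (h1.sub (h2.aestronglyMeasurable measurableSet_Icc)).congr (.of_forall fun τ => ?_)
  simp

variable {v G : ℝ → ℂ} {γ ω : ℝ}

lemma integral_norm_le_of_mem_Icc (hG : IntegrableOn G (Icc 0 1)) {t : ℝ}
    (ht : t ∈ Icc (0 : ℝ) 1) : ∫ τ in (0 : ℝ)..t, ‖G τ‖ ≤ ∫ τ in (0 : ℝ)..1, ‖G τ‖ := by
  refine intervalIntegral.integral_mono_interval le_rfl ht.1 ht.2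
    (.of_forall fun τ => norm_nonneg _) ?_
  rw [intervalIntegrable_iff_integrableOn_Icc_of_le zero_le_one]
  exact hG.norm

lemma norm_le_of_dissipative (hγ : 0 ≤ γ)
    (hv : ∀ τ ∈ Icc (0 : ℝ) 1,
      HasDerivWithinAt v (Complex.I * ω * v τ - γ * v τ + G τ) (Icc 0 1) τ)
    (hG : IntegrableOn G (Icc 0 1)) {t : ℝ} (ht : t ∈ Icc (0 : ℝ) 1) :
    ‖v t‖ ≤ ‖v 0‖ + ∫ τ in (0 : ℝ)..1, ‖G τ‖ := by
  have h1 := norm_add_mul_integral_norm_le hγ hv hG ht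
  have h2 := integral_norm_le_of_mem_Icc hG ht
  have h3 : 0 ≤ γ * ∫ τ in (0 : ℝ)..t, ‖v τ‖ :=
    mul_nonneg hγ (intervalIntegral.integral_nonneg ht.1 fun _ _ => norm_nonneg _)
  linarith

lemma integrableOn_interaction_deriv
    (hv : ∀ τ ∈ Icc (0 : ℝ) 1,
      HasDerivWithinAt v (Complex.I * ω * v τ - γ * v τ + G τ) (Icc 0 1) τ)
    (hG : IntegrableOn G (Icc 0 1)) :
    IntegrableOn (fun τ : ℝ => Complex.exp (-Complex.I * ω * τ) * (-γ * v τ + G τ)) (Icc 0 1) := by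
  have hvc : ContinuousOn v (Icc 0 1) := fun τ hτ => (hv τ hτ).continuousWithinAt
  have h1 : IntegrableOn (fun τ => -γ * v τ) (Icc 0 1) :=
    ContinuousOn.integrableOn_Icc (by fun_prop)
  exact (h1.add hG).continuousOn_mul (by fun_prop) isCompact_Icc

lemma integral_norm_interaction_deriv_le (hγ : 0 ≤ γ)
    (hv : ∀ τ ∈ Icc (0 : ℝ) 1,
      HasDerivWithinAt v (Complex.I * ω * v τ - γ * v τ + G τ) (Icc 0 1) τ)
    (hG : IntegrableOn G (Icc 0 1)) {t : ℝ} (ht : t ∈ Icc (0 : ℝ) 1) :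
    ∫ τ in (0 : ℝ)..t, ‖Complex.exp (-Complex.I * ω * τ) * (-γ * v τ + G τ)‖ ≤
      2 * (‖v 0‖ + ∫ τ in (0 : ℝ)..1, ‖G τ‖) := by
  have hsub : Icc 0 t ⊆ Icc (0 : ℝ) 1 := Icc_subset_Icc_right ht.2
  have hvc : ContinuousOn v (Icc 0 1) := fun τ hτ => (hv τ hτ).continuousWithinAt
  have hvi : IntervalIntegrable (fun τ => ‖v τ‖) volume 0 t := by
    refine ContinuousOn.intervalIntegrable ?_
    rw [uIcc_of_le ht.1]
    exact (hvc.mono hsub).norm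
  have hGi : IntervalIntegrable (fun τ => ‖G τ‖) volume 0 t := by
    rw [intervalIntegrable_iff_integrableOn_Icc_of_le ht.1]
    exact (hG.mono_set hsub).norm
  have hi : IntervalIntegrable
      (fun τ : ℝ => ‖Complex.exp (-Complex.I * ω * τ) * (-γ * v τ + G τ)‖) volume 0 t := by
    rw [intervalIntegrable_iff_integrableOn_Icc_of_le ht.1]
    exact ((integrableOn_interaction_deriv hv hG).mono_set hsub).norm
  have h1 := norm_add_mul_integral_norm_le hγ hv hG ht
  have h2 := integral_norm_le_of_mem_Icc hG ht
  have h3 : ∫ τ in (0 : ℝ)..t, ‖Complex.exp (-Complex.I * ω * τ) * (-γ * v τ + G τ)‖ ≤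
      ∫ τ in (0 : ℝ)..t, (γ * ‖v τ‖ + ‖G τ‖) := by
    refine intervalIntegral.integral_mono_on ht.1 hi ((hvi.const_mul _).add hGi) fun τ _ => ?_
    rw [norm_mul, norm_exp_neg_I_mul, one_mul]
    refine (norm_add_le _ _).trans_eq ?_
    rw [norm_mul, norm_neg, Complex.norm_real, Real.norm_of_nonneg hγ]
  rw [intervalIntegral.integral_add (hvi.const_mul _) hGi,
    intervalIntegral.integral_const_mul] at h3
  linarith [norm_nonneg (v t), norm_nonneg (v 0)]

end Dissipation

/-- key averaging lemma: with `d, m, p, q ≥ 1`, `μ ≥ 0`, `b, c ∈ ℝ`,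
`s > d/2`, `s₁ ∈ (d/2, s)` with `s − s₁ ≤ m`, `M > 0` and `ε ∈ (0,1)`, for every
`h^s`-continuous solution `v` of the rescaled CGL system on `[0,1]` with `|v(τ)|_s ≤ M`,
the interaction representation `a_k(τ) = e^{−iε⁻¹λ_kτ}v_k(τ)` satisfies, for every
`τ̃ ∈ [0,1]`,
`|∫₀^{τ̃} (Y(a(τ),τ) − R(a(τ))) dτ|_{s₁} ≤ C(ε^{(s−s₁)/m} + ε^{1/2})`,
where `Y(w,τ) = Φ_{−τε⁻¹Λ}P(Φ_{τε⁻¹Λ}w)`, `P(w)_k = bP_k(w,p) + icP_k(w,q)`,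
`R(w)_k = bR_k(w,p) + icR_k(w,q)`, the integral being taken coordinatewise, and `C`
depends only on `d, m, p, q, μ, b, c, s, s₁, M` (not on `ε`). -/
theorem key_averaging_lemma (d m p q : ℕ) (hd : 1 ≤ d) (hm : 1 ≤ m)
    (hp : 1 ≤ p) (hq : 1 ≤ q) (μ b c : ℝ) (hμ : 0 ≤ μ) (s s₁ M : ℝ)
    (hs : (d : ℝ) / 2 < s) (hs₁l : (d : ℝ) / 2 < s₁) (hs₁u : s₁ < s)
    (hsm : s - s₁ ≤ (m : ℝ)) (hM : 0 < M) :
    ∃ C : ℝ, 0 < C ∧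
      ∀ ε : ℝ, 0 < ε → ε < 1 →
      ∀ v a : ℝ → (Fin d → ℤ) → ℂ,
        (∀ τ ∈ Set.Icc (0 : ℝ) 1, memH d s (v τ) ∧ hnorm d s (v τ) ≤ M) →
        hContOn d s 1 v →
        (∀ τ ∈ Set.Icc (0 : ℝ) 1, ∀ k : Fin d → ℤ,
          HasDerivWithinAt (fun t => v t k)
            (((ε : ℂ))⁻¹ * Complex.I * (lam d k : ℂ) * v τ k
              - (μ : ℂ) * (lam d k : ℂ) ^ m * v τ k
              + (b : ℂ) * Pk d p (v τ) k + Complex.I * (c : ℂ) * Pk d q (v τ) k)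
            (Set.Icc 0 1) τ) →
        (∀ τ : ℝ, ∀ k : Fin d → ℤ,
          a τ k = Complex.exp (-Complex.I * ((ε : ℂ))⁻¹ * (lam d k : ℂ) * (τ : ℂ))
            * v τ k) →
        ∀ τt ∈ Set.Icc (0 : ℝ) 1,
          hnorm d s₁ (fun k =>
            ∫ τ in (0 : ℝ)..τt,
              (Complex.exp (-Complex.I * ((ε : ℂ))⁻¹ * (lam d k : ℂ) * (τ : ℂ)) *
                  ((b : ℂ) * Pk d p (fun j =>
                      Complex.exp (Complex.I * ((ε : ℂ))⁻¹ * (lam d j : ℂ) * (τ : ℂ))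
                        * a τ j) k
                    + Complex.I * (c : ℂ) * Pk d q (fun j =>
                      Complex.exp (Complex.I * ((ε : ℂ))⁻¹ * (lam d j : ℂ) * (τ : ℂ))
                        * a τ j) k)
                - ((b : ℂ) * Rk d p (a τ) k + Complex.I * (c : ℂ) * Rk d q (a τ) k)))
            ≤ C * (ε ^ ((s - s₁) / (m : ℝ)) + ε ^ ((1 : ℝ) / 2)) := by
  have hd0 : (0 : ℝ) < d := by exact_mod_cast hd
  have hs₁0 : 0 < s₁ := by linarith
  have hK := algConst_ne_top hd hs₁l
  set K := algConst d s₁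
  set E₀ : ℝ≥0∞ := 2 * ENNReal.ofReal (M ^ 2) with hE₀
  set E₁ : ℝ≥0∞ := 2 * (‖(b : ℂ)‖ₑ ^ 2 * (K * E₀) ^ (2 * p + 1) +
    ‖(c : ℂ)‖ₑ ^ 2 * (K * E₀) ^ (2 * q + 1)) with hE₁
  set E₂ : ℝ≥0∞ := 2 * (E₀ + E₁) with hE₂
  set β : ℝ≥0∞ := ‖(b : ℂ)‖ₑ * ENNReal.ofReal (4 * p + 4) with hβ
  set γ : ℝ≥0∞ := ‖(c : ℂ)‖ₑ * ENNReal.ofReal (4 * q + 4) with hγ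
  set E₃ : ℝ≥0∞ := 2 * (β ^ 2 * (K * E₂) ^ (2 * p + 1) + γ ^ 2 * (K * E₂) ^ (2 * q + 1)) with hE₃
  have hE₀t : E₀ ≠ ∞ := by finiteness
  have hE₁t : E₁ ≠ ∞ := by finiteness
  have hE₂t : E₂ ≠ ∞ := by finiteness
  have hE₃t : E₃ ≠ ∞ := by finiteness
  refine ⟨√E₃.toReal + 1, by positivity, ?_⟩
  intro ε hε hε1 v a hv _ hode ha t ht
  set G : ℝ → (Fin d → ℤ) → ℂ := fun τ k =>
    (b : ℂ) * Pk d p (v τ) k + Complex.I * (c : ℂ) * Pk d q (v τ) k with hG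
  have hode' : ∀ k, ∀ τ ∈ Icc (0 : ℝ) 1, HasDerivWithinAt (fun t => v t k)
      (Complex.I * (ε⁻¹ * lam d k : ℝ) * v τ k - (μ * lam d k ^ m : ℝ) * v τ k + G τ k)
      (Icc 0 1) τ := fun k τ hτ => by
    refine (hode τ hτ k).congr_deriv ?_
    simp only [hG]
    push_cast
    ring
  have hμk : ∀ k : Fin d → ℤ, 0 ≤ μ * (lam d k : ℝ) ^ m := fun k =>
    mul_nonneg hμ (pow_nonneg (lam_cast_nonneg k) m)
  have hvE : ∀ τ ∈ Icc (0 : ℝ) 1, energy d s₁ (fun k => ‖v τ k‖ₑ) ≤ E₀ := fun τ hτ => by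
    refine (energy_le_two_mul_energy hs₁0 hs₁u.le _).trans ?_
    rw [energy_enorm_eq_ofReal s (hv τ hτ).1]
    have : hnorm d s (v τ) ^ 2 ≤ M ^ 2 :=
      pow_le_pow_left₀ (Real.sqrt_nonneg _) (hv τ hτ).2 2
    exact mul_le_mul_right (ENNReal.ofReal_le_ofReal this) _
  have hGE : ∀ τ ∈ Icc (0 : ℝ) 1, energy d s₁ (fun k => ‖G τ k‖ₑ) ≤ E₁ := fun τ hτ =>
    (energy_mono fun k => enorm_add_Pk_le p q b c (v τ) k).trans
      (energy_add_signedConv_le hs₁0 p q _ _ (hvE τ hτ))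
  have hGm : ∀ k, AEStronglyMeasurable (fun τ => G τ k) (volume.restrict (Icc 0 1)) :=
    fun k => aestronglyMeasurable_forcing (hode' k)
  have : IsProbabilityMeasure (volume.restrict (Icc (0 : ℝ) 1)) := ⟨by simp⟩
  have hGI : energy d s₁ (fun k => ∫⁻ τ in Icc (0 : ℝ) 1, ‖G τ k‖ₑ) ≤ E₁ := by
    refine (energy_lintegral_le _ fun k => (hGm k).enorm).trans ?_
    refine (lintegral_mono_ae (g := fun _ => E₁) ?_).trans (by simp)
    filter_upwards [ae_restrict_mem measurableSet_Icc] with τ hτ using hGE τ hτ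
  have hGi : ∀ k, IntegrableOn (fun τ => G τ k) (Icc 0 1) := fun k =>
    ⟨hGm k, lt_top_of_energy_ne_top (ne_top_of_le_ne_top hE₁t hGI) k⟩
  set A : (Fin d → ℤ) → ℝ := fun k => ‖v 0 k‖ + ∫ τ in (0 : ℝ)..1, ‖G τ k‖ with hA
  have hAE : energy d s₁ (fun k => ENNReal.ofReal (A k)) ≤ E₂ := by
    have hAk : ∀ k, ENNReal.ofReal (A k) = ‖v 0 k‖ₑ + ∫⁻ τ in Icc (0 : ℝ) 1, ‖G τ k‖ₑ :=
      fun k => by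
        rw [hA, ENNReal.ofReal_add (norm_nonneg _)
          (intervalIntegral.integral_nonneg zero_le_one fun _ _ => norm_nonneg _), ofReal_norm,
          intervalIntegral.integral_of_le zero_le_one, ← integral_Icc_eq_integral_Ioc,
          ofReal_integral_norm_eq_lintegral_enorm (hGi k)]
    simp only [hAk]
    refine (energy_add_le s₁ _ _).trans ?_
    exact mul_le_mul_right (add_le_add (hvE 0 (by simp)) hGI) _
  have haeq : ∀ l : Fin d → ℤ, (fun τ => a τ l) = fun τ : ℝ =>
      Complex.exp (-Complex.I * (ε⁻¹ * lam d l : ℝ) * τ) * v τ l := fun l => by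
    ext τ
    rw [ha]
    push_cast
    ring_nf
  have hterm : ∀ n : ℕ, ∀ k : Fin d → ℤ, _ := fun n k => integral_Pk_sub_Rk (n := n) (k := k) hε
    (a := a) (A := A)
    (a' := fun τ l => Complex.exp (-Complex.I * (ε⁻¹ * lam d l : ℝ) * τ) *
      (-(μ * lam d l ^ m : ℝ) * v τ l + G τ l))
    (fun l τ hτ => by
      rw [haeq]
      exact hasDerivWithinAt_interaction (v := fun t => v t l) (G := fun t => G t l) (hode' l τ hτ))
    (fun l => integrableOn_interaction_deriv (v := fun t => v t l) (G := fun t => G t l)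
      (hode' l) (hGi l))
    (fun l τ hτ => by
      rw [congrFun (haeq l) τ, norm_mul, norm_exp_neg_I_mul, one_mul]
      exact norm_le_of_dissipative (v := fun t => v t l) (G := fun t => G t l) (hμk l) (hode' l) (hGi l) hτ)
    (fun l τ hτ => integral_norm_interaction_deriv_le (v := fun t => v t l)
      (G := fun t => G t l) (hμk l) (hode' l) (hGi l) hτ) ht
    (lt_top_of_energy_ne_top (ne_top_of_le_ne_top (by finiteness)
      ((energy_signedConv_le hs₁0 altSign_sq _).trans
        (pow_le_pow_left' (mul_le_mul_right hAE K) _))) k).ne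
  have hεle : ε ≤ ε ^ ((s - s₁) / (m : ℝ)) + ε ^ ((1 : ℝ) / 2) := by
    have h1 : ε ≤ ε ^ ((1 : ℝ) / 2) := by
      simpa using Real.rpow_le_rpow_of_exponent_ge hε hε1.le (show (1 : ℝ) / 2 ≤ 1 by norm_num)
    have h2 : 0 ≤ ε ^ ((s - s₁) / (m : ℝ)) := by positivity
    linarith
  refine (hnorm_le_of_energy_le (K := ε * √E₃.toReal) (by positivity) ?_).trans ?_
  swap
  · rw [mul_comm]
    gcongr
    linarith
  rw [mul_pow, Real.sq_sqrt ENNReal.toReal_nonneg, ENNReal.ofReal_mul (by positivity),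
    ENNReal.ofReal_toReal hE₃t, ENNReal.ofReal_pow hε.le]
  refine le_trans (energy_mono fun k => ?_) ((energy_const_mul s₁ (ENNReal.ofReal ε) _).trans_le
    (mul_le_mul_right (energy_add_signedConv_le hs₁0 p q β γ hAE) _))
  obtain ⟨hip, hbp⟩ := hterm p k
  obtain ⟨hiq, hbq⟩ := hterm q k
  calc _ = ‖(b : ℂ) * (∫ τ in (0 : ℝ)..t, _) + Complex.I * c * ∫ τ in (0 : ℝ)..t, _‖ₑ := by
        rw [← intervalIntegral.integral_const_mul, ← intervalIntegral.integral_const_mul,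
          ← intervalIntegral.integral_add (hip.const_mul _) (hiq.const_mul _)]
        congr 1
        refine intervalIntegral.integral_congr fun τ _ => ?_
        ring
    _ ≤ ‖(b : ℂ)‖ₑ * (ENNReal.ofReal (ε * (4 * p + 4)) * _) +
          ‖(c : ℂ)‖ₑ * (ENNReal.ofReal (ε * (4 * q + 4)) * _) := by
        refine (enorm_add_le _ _).trans ?_
        rw [enorm_mul, enorm_mul, enorm_mul, ← ofReal_norm Complex.I, Complex.norm_I,
          ENNReal.ofReal_one, one_mul]
        gcongr
    _ = _ := by
        rw [ENNReal.ofReal_mul hε.le, ENNReal.ofReal_mul hε.le, hβ, hγ]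
        ring
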